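/- There is no increasing sequence of Borel sets A_0 ⊆ A_1 ⊆ … with 2^ω = ⋃_k A_k such that the equivalence relations (≡_T) ↾ A_k witness that Turing equivalence is hyper-recursively-finite. Precisely: for every increasing sequence (A_k)_{k∈ω} of Borel subsets of 2^ω with ⋃_k A_k = 2^ω, there exist some n, some x ∈ A_n, and some y ≤_T x such that the set of columns of y is an infinite subset of {z ∈ A_n : z ≡_T x}. -/

import Mathlib

open scoped Classical

namespace SlamanSteel

/-- Partial recursive functions relative to an oracle `O : ℕ → ℕ`
(Mathlib's `Nat.Partrec` with an extra oracle clause). -/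
inductive RecursiveIn (O : ℕ → ℕ) : (ℕ →. ℕ) → Prop
  | zero : RecursiveIn O (pure 0)
  | succ : RecursiveIn O fun n : ℕ => Part.some (Nat.succ n)
  | left : RecursiveIn O fun n : ℕ => Part.some (Nat.unpair n).1
  | right : RecursiveIn O fun n : ℕ => Part.some (Nat.unpair n).2
  | oracle : RecursiveIn O fun n : ℕ => Part.some (O n)
  | pair {f g : ℕ →. ℕ} : RecursiveIn O f → RecursiveIn O g →
      RecursiveIn O fun n => Nat.pair <$> f n <*> g n
  | comp {f g : ℕ →. ℕ} : RecursiveIn O f → RecursiveIn O g →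
      RecursiveIn O fun n => g n >>= f
  | prec {f g : ℕ →. ℕ} : RecursiveIn O f → RecursiveIn O g →
      RecursiveIn O (Nat.unpaired fun a n =>
        n.rec (f a) fun y IH => do { let i ← IH; g (Nat.pair a (Nat.pair y i)) })
  | rfind {f : ℕ →. ℕ} : RecursiveIn O f →
      RecursiveIn O fun a => Nat.rfind fun n => (fun m => m = 0) <$> f (Nat.pair a n)

/-- The oracle (as a function `ℕ → ℕ`) associated to a real `x ∈ 2^ω`. -/
def oracleOf (x : ℕ → Bool) : ℕ → ℕ := fun n => cond (x n) 1 0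

/-- `z ≤_T x` : `z` is computable relative to the oracle `x`. -/
def TuringLE (z x : ℕ → Bool) : Prop :=
  RecursiveIn (oracleOf x) fun n => Part.some (oracleOf z n)

/-- Turing equivalence on `2^ω`. -/
def TuringEquiv (x y : ℕ → Bool) : Prop := TuringLE x y ∧ TuringLE y x

/-- The `j`th column of `y ∈ 2^ω`. -/
def column (y : ℕ → Bool) (j : ℕ) : ℕ → Bool := fun m => y (Nat.pair j m)

/-- `x ≤_m y` : many-one reducibility on `2^ω`. -/
def MLE (x y : ℕ → Bool) : Prop :=
  ∃ ρ : ℕ → ℕ, Computable ρ ∧ ∀ n, x n = y (ρ n)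

/-- `x ≡_m y` : many-one equivalence on `2^ω`. -/
def MEquiv (x y : ℕ → Bool) : Prop := MLE x y ∧ MLE y x

/-- `x ≤₁ y` : one-one reducibility on `2^ω`. -/
def OneLE (x y : ℕ → Bool) : Prop :=
  ∃ ρ : ℕ → ℕ, Computable ρ ∧ Function.Injective ρ ∧ ∀ n, x n = y (ρ n)

/-- `x ≡₁ y` : one-one equivalence on `2^ω`. -/
def OneEquiv (x y : ℕ → Bool) : Prop := OneLE x y ∧ OneLE y x

/-- The complement `x̄` of a real, flipping every bit. -/
def flipBits (x : ℕ → Bool) : ℕ → Bool := fun n => !(x n)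

/-- The computable join `⊕_i z_i` of a sequence of reals: `(⊕_i z_i)(⟨i,m⟩) = z_i(m)`. -/
def joinSeq (z : ℕ → ℕ → Bool) : ℕ → Bool :=
  fun k => z (Nat.unpair k).1 (Nat.unpair k).2

/-- The computable join of finitely many reals. -/
def joinFin {n : ℕ} (z : Fin n → ℕ → Bool) : ℕ → Bool := fun k =>
  if h : (Nat.unpair k).1 < n then z ⟨(Nat.unpair k).1, h⟩ (Nat.unpair k).2 else false

/-- The initial segment of `x` of length `k`, as a binary string. -/
def initSeg (x : ℕ → Bool) (k : ℕ) : List Bool := (List.range k).map x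

/-- `W` is a set of strings which is computably enumerable relative to the oracle `x`. -/
def CEIn (x : ℕ → Bool) (W : Set (List Bool)) : Prop :=
  ∃ f : ℕ →. ℕ, RecursiveIn (oracleOf x) f ∧
    ∀ σ : List Bool, σ ∈ W ↔ (f (Encodable.encode σ)).Dom

/-- `g` is `x`-generic (1-generic relative to `x`). -/
def GenericIn (x g : ℕ → Bool) : Prop :=
  ∀ W : Set (List Bool), CEIn x W →
    ∃ k, initSeg g k ∈ W ∨ ∀ τ : List Bool, initSeg g k <+: τ → τ ∉ W

/-- `g` is 1-generic. -/
def OneGeneric (g : ℕ → Bool) : Prop := GenericIn (fun _ => false) g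

/-- Reals `z 0, …, z (n-1)` are mutually 1-generic if their join is 1-generic. -/
def MutuallyOneGeneric {n : ℕ} (z : Fin n → ℕ → Bool) : Prop := OneGeneric (joinFin z)

/-- `E` is hyper-`(f_i)`-finite: `E` is an increasing union of Borel subequivalence
relations none of which has a class containing an infinite set `{f i x j : j ∈ ω}`. -/
def HyperFinWrt {X : Type*} [MeasurableSpace X] (E : X → X → Prop)
    (f : ℕ → X → ℕ → X) : Prop :=
  ∃ F : ℕ → X → X → Prop,
    (∀ n, Equivalence (F n)) ∧
    (∀ n, MeasurableSet {p : X × X | F n p.1 p.2}) ∧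
    (∀ n a b, F n a b → F (n + 1) a b) ∧
    (∀ a b, E a b ↔ ∃ n, F n a b) ∧
    (∀ n x i, (Set.range (f i x)).Infinite → ¬ Set.range (f i x) ⊆ {y | F n x y})

/-- `E` is hyper-Borel-finite: hyper-`(f_i)`-finite for every countable sequence of
Borel functions `f_i : X → X^ω`. -/
def HyperBorelFinite {X : Type*} [MeasurableSpace X] (E : X → X → Prop) : Prop :=
  ∀ f : ℕ → X → ℕ → X, (∀ i, Measurable (f i)) → HyperFinWrt E f

/-- Turing equivalence is hyper-recursively-finite: it is an increasing union of Borel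
equivalence relations `F n` such that no `F n`-class of `x` contains, as an infinite
subset, the set of columns of some `y ≤_T x`. -/
def HyperRecFin : Prop :=
  ∃ F : ℕ → (ℕ → Bool) → (ℕ → Bool) → Prop,
    (∀ n, Equivalence (F n)) ∧
    (∀ n, MeasurableSet {p : (ℕ → Bool) × (ℕ → Bool) | F n p.1 p.2}) ∧
    (∀ n a b, F n a b → F (n + 1) a b) ∧
    (∀ a b, TuringEquiv a b ↔ ∃ n, F n a b) ∧
    (∀ n x y, TuringLE y x → (Set.range (column y)).Infinite →
      ¬ Set.range (column y) ⊆ {z | F n x z})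

theorem RecursiveIn.of_partrec (O : ℕ → ℕ) {f : ℕ →. ℕ} (hf : Nat.Partrec f) :
    RecursiveIn O f := by
  induction hf with
  | zero => exact .zero
  | succ => exact .succ
  | left => exact .left
  | right => exact .right
  | pair _ _ ihf ihg => exact .pair ihf ihg
  | comp _ _ ihf ihg => exact .comp ihf ihg
  | prec _ _ ihf ihg => exact .prec ihf ihg
  | rfind _ ih => exact .rfind ih

theorem RecursiveIn.of_primrec (O : ℕ → ℕ) {f : ℕ → ℕ} (hf : Primrec f) :
    RecursiveIn O fun n => Part.some (f n) :=
  .of_partrec O (.of_primrec (Primrec.nat_iff.1 hf))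

theorem turingLE_of_xor {w x : ℕ → Bool} {g : ℕ → ℕ} {e : ℕ → Bool} (hg : Primrec g)
    (he : Primrec e) (h : ∀ n, w n = xor (x (g n)) (e n)) : TuringLE w x := by
  have hP : Primrec fun p : ℕ => cond (e p.unpair.1) (1 - p.unpair.2) p.unpair.2 :=
    Primrec.cond (he.comp (Primrec.fst.comp Primrec.unpair))
      (Primrec.nat_sub.comp (Primrec.const 1) (Primrec.snd.comp Primrec.unpair))
      (Primrec.snd.comp Primrec.unpair)
  have key := (RecursiveIn.of_primrec (oracleOf x) hP).comp
    ((RecursiveIn.of_primrec (oracleOf x) Primrec.id).pair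
      (RecursiveIn.oracle.comp (RecursiveIn.of_primrec (oracleOf x) hg)))
  unfold TuringLE
  refine (congrArg (RecursiveIn (oracleOf x)) (funext fun n => ?_)).mpr key
  cases hx : x (g n) <;> cases hn : e n <;> simp [oracleOf, h, hx, hn, Seq.seq]

/-- Flip the `k`th bit of `x`. -/
def flipAt (k : ℕ) (x : ℕ → Bool) : ℕ → Bool := fun m => xor (x m) (decide (m = k))

theorem flipAt_flipAt (k : ℕ) (x : ℕ → Bool) : flipAt k (flipAt k x) = x := by
  funext m
  simp [flipAt]

theorem flipAt_injective (x : ℕ → Bool) : Function.Injective fun k => flipAt k x := by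
  intro k l h
  by_contra hkl
  simpa [flipAt, hkl] using congrFun h k

theorem continuous_flipAt (k : ℕ) : Continuous (flipAt k) :=
  continuous_pi fun m => (continuous_of_discreteTopology
    (f := fun b : Bool => xor b (decide (m = k)))).comp (continuous_apply m)

theorem isOpenMap_flipAt (k : ℕ) : IsOpenMap (flipAt k) :=
  IsOpenMap.of_inverse (continuous_flipAt k) (flipAt_flipAt k) (flipAt_flipAt k)

theorem turingEquiv_flipAt (k : ℕ) (x : ℕ → Bool) : TuringEquiv (flipAt k x) x := by
  have he : Primrec fun m : ℕ => decide (m = k) :=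
    (Primrec.eq.comp Primrec.id (Primrec.const k)).decide
  refine ⟨turingLE_of_xor Primrec.id he fun _ => rfl, turingLE_of_xor Primrec.id he fun m => ?_⟩
  exact (congrFun (flipAt_flipAt k x) m).symm

theorem turingLE_joinSeq_flipAt (N : ℕ) (x : ℕ → Bool) :
    TuringLE (joinSeq fun j => flipAt (N + j) x) x :=
  turingLE_of_xor (Primrec.snd.comp Primrec.unpair)
    (Primrec.eq.comp (Primrec.snd.comp Primrec.unpair)
      (Primrec.nat_add.comp (Primrec.const N) (Primrec.fst.comp Primrec.unpair))).decide
    fun _ => rfl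

theorem column_joinSeq (z : ℕ → ℕ → Bool) : column (joinSeq z) = z := by
  funext j m
  simp [column, joinSeq]

/-- An open set containing `x` contains the cylinder of some finite initial segment of `x`. -/
theorem exists_cylinder_subset {u : Set (ℕ → Bool)} (hu : IsOpen u) {x : ℕ → Bool}
    (hx : x ∈ u) : ∃ N, PiNat.cylinder x N ⊆ u := by
  obtain ⟨v, ⟨y, N, rfl⟩, hxv, hvu⟩ :=
    (PiNat.isTopologicalBasis_cylinders fun _ : ℕ => Bool).exists_subset_of_mem_open hx hu
  exact ⟨N, by rwa [PiNat.mem_cylinder_iff_eq.1 hxv]⟩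

/-- If countably many sets with the Baire property cover a nonempty Baire space, one of them
is residually equal to a nonempty open set. -/
theorem exists_residualEq_open_nonempty {X : Type*} [TopologicalSpace X] [BaireSpace X]
    [Nonempty X] [MeasurableSpace X] [BorelSpace X] {A : ℕ → Set X}
    (hA : ∀ k, MeasurableSet (A k)) (hcover : (⋃ k, A k) = Set.univ) :
    ∃ n, ∃ u : Set X, IsOpen u ∧ u.Nonempty ∧ ∀ᶠ x in residual X, x ∈ A n ↔ x ∈ u := by
  by_contra hcon
  choose u hu hAu using fun k => (hA k).residualEq_isOpen
  have hAu' : ∀ k, ∀ᶠ x in residual X, x ∈ A k ↔ x ∈ u k := fun k =>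
    (hAu k).mono fun x hx => iff_of_eq hx
  have hempty : ∀ k, u k = ∅ := fun k => by
    by_contra hne
    exact hcon ⟨k, u k, hu k, Set.nonempty_iff_ne_empty.2 hne, hAu' k⟩
  obtain ⟨x, hx⟩ := (dense_of_mem_residual (eventually_countable_forall.2 hAu')).nonempty
  obtain ⟨k, hk⟩ := Set.mem_iUnion.1 (hcover.symm ▸ Set.mem_univ x : x ∈ ⋃ k, A k)
  exact Set.notMem_empty x (hempty k ▸ (hx k).1 hk)

/-- There is no increasing sequence of Borel sets `A_0 ⊆ A_1 ⊆ …` covering `2^ω`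
such that the relations `(≡_T) ↾ A_k` witness that Turing equivalence is
hyper-recursively-finite: for every such sequence there are `n`, `x ∈ A_n`, and
`y ≤_T x` such that the set of columns of `y` is an infinite subset of
`{z ∈ A_n : z ≡_T x}`. -/
theorem no_restriction_witness
    (A : ℕ → Set (ℕ → Bool))
    (hABorel : ∀ k, MeasurableSet (A k))
    (hAmono : ∀ k, A k ⊆ A (k + 1))
    (hAcover : (⋃ k, A k) = Set.univ) :
    ∃ n, ∃ x ∈ A n, ∃ y, TuringLE y x ∧
      (Set.range (column y)).Infinite ∧
      Set.range (column y) ⊆ {z | z ∈ A n ∧ TuringEquiv z x} := by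
  obtain ⟨n, u, hu, ⟨x₀, hx₀⟩, hAu⟩ := exists_residualEq_open_nonempty hABorel hAcover
  obtain ⟨N, hN⟩ := exists_cylinder_subset hu hx₀
  have hflip : ∀ k, ∀ᶠ x in residual (ℕ → Bool), flipAt k x ∈ A n ↔ flipAt k x ∈ u := fun k =>
    (tendsto_residual_of_isOpenMap (continuous_flipAt k) (isOpenMap_flipAt k)).eventually hAu
  obtain ⟨x, hxc, hx, hxf⟩ :=
    (dense_of_mem_residual (hAu.and (eventually_countable_forall.2 hflip))).inter_open_nonempty
      (PiNat.cylinder x₀ N) (PiNat.isOpen_cylinder _ x₀ N) ⟨x₀, PiNat.self_mem_cylinder x₀ N⟩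
  refine ⟨n, x, hx.2 (hN hxc), joinSeq fun j => flipAt (N + j) x,
    turingLE_joinSeq_flipAt N x, ?_, ?_⟩
  · rw [column_joinSeq]
    exact Set.infinite_range_of_injective ((flipAt_injective x).comp (add_right_injective N))
  · rw [column_joinSeq]
    rintro _ ⟨j, rfl⟩
    refine ⟨(hxf (N + j)).2 (hN fun i hi => ?_), turingEquiv_flipAt (N + j) x⟩
    have hne : i ≠ N + j := by omega
    simpa [flipAt, hne] using hxc i hi

end SlamanSteel
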